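/- Let α > 0 and i ∈ {1,2}. Define v^{F_i} := ∂_i v^G (the velocity field associated with F_i = ∂_i G), Γ(ξ,τ) = G(ξ) - α² e^{-τ} ΔG(ξ) and Λ_i(ξ,τ) = F_i(ξ) - α² e^{-τ} ΔF_i(ξ). Then for every ξ ∈ ℝ² with ξ ≠ 0 and every τ ∈ ℝ, v^{F_i}(ξ) · ∇_ξ Γ(ξ,τ) + v^G(ξ) · ∇_ξ Λ_i(ξ,τ) = 0. -/

import Mathlib

open MeasureTheory Real ENNReal
open scoped Classical

noncomputable section

abbrev E2 := EuclideanSpace ℝ (Fin 2)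

def e (i : Fin 2) : E2 := EuclideanSpace.single i 1

/-- Partial derivative in the `i`-th coordinate direction. -/
def pd (i : Fin 2) (f : E2 → ℝ) (x : E2) : ℝ := fderiv ℝ f x (e i)

/-- The Laplacian on `ℝ²`. -/
def lap (f : E2 → ℝ) (x : E2) : ℝ := ∑ i : Fin 2, pd i (pd i f) x

/-- `x^⊥ = (-x₂, x₁)`. -/
def perp (x : E2) : E2 := (WithLp.equiv 2 (Fin 2 → ℝ)).symm ![-x 1, x 0]

/-- The Gaussian `G(ξ) = (1/4π) e^{-|ξ|²/4}`. -/
def G (ξ : E2) : ℝ := (4 * π)⁻¹ * Real.exp (-‖ξ‖ ^ 2 / 4)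

/-- `F_i = ∂_i G`. -/
def F (i : Fin 2) (ξ : E2) : ℝ := pd i G ξ

/-- The Oseen vortex velocity field `v^G`. -/
def vG (ξ : E2) : E2 :=
  if ξ = 0 then 0 else ((2 * π)⁻¹ * ((1 - Real.exp (-‖ξ‖ ^ 2 / 4)) / ‖ξ‖ ^ 2)) • perp ξ

/-- `v^{F_i} = ∂_i v^G`, the velocity field associated with `F_i`. -/
def vF (i : Fin 2) (ξ : E2) : E2 := fderiv ℝ vG ξ (e i)

/-- `Γ(ξ,τ) = G(ξ) - α² e^{-τ} ΔG(ξ)`. -/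
def Γfn (α : ℝ) (ξ : E2) (τ : ℝ) : ℝ := G ξ - α ^ 2 * Real.exp (-τ) * lap G ξ

/-- `Λ_i(ξ,τ) = F_i(ξ) - α² e^{-τ} ΔF_i(ξ)`. -/
def Λfn (α : ℝ) (i : Fin 2) (ξ : E2) (τ : ℝ) : ℝ :=
  F i ξ - α ^ 2 * Real.exp (-τ) * lap (F i) ξ


def EE (a b : ℝ) (x : E2) : ℝ := (a + b * ‖x‖ ^ 2) * Real.exp (-‖x‖ ^ 2 / 4)

lemma EE_hasFDerivAt (a b : ℝ) (x : E2) :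
    HasFDerivAt (EE a b) ((2 * EE (b - a / 4) (-b / 4) x) • innerSL ℝ x) x := by
  have h1 : HasFDerivAt (fun y : E2 => ‖y‖ ^ 2) (2 • (innerSL ℝ x)) x :=
    (hasStrictFDerivAt_norm_sq x).hasFDerivAt
  have h2 : HasDerivAt (fun r : ℝ => (a + b * r) * Real.exp (-r / 4))
      (b * Real.exp (-‖x‖ ^ 2 / 4) + (a + b * ‖x‖ ^ 2) * (Real.exp (-‖x‖ ^ 2 / 4) * (-1 / 4)))
      (‖x‖ ^ 2) := by
    have h3 : HasDerivAt (fun r : ℝ => a + b * r) b (‖x‖ ^ 2) := by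
      simpa using ((hasDerivAt_id (‖x‖ ^ 2)).const_mul b).const_add a
    exact h3.mul (((hasDerivAt_id (‖x‖ ^ 2)).neg.div_const 4).exp)
  refine (h2.comp_hasFDerivAt x h1).congr_fderiv ?_
  ext v
  simp [EE]
  ring

lemma coord_hasFDerivAt (i : Fin 2) (x : E2) :
    HasFDerivAt (fun y : E2 => y i) (EuclideanSpace.proj i : E2 →L[ℝ] ℝ) x :=
  (EuclideanSpace.proj i : E2 →L[ℝ] ℝ).hasFDerivAt

lemma EEc_hasFDerivAt (a b : ℝ) (i : Fin 2) (x : E2) :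
    HasFDerivAt (fun y => EE a b y * y i) (EE a b x • (EuclideanSpace.proj i : E2 →L[ℝ] ℝ) +
      x i • ((2 * EE (b - a / 4) (-b / 4) x) • innerSL ℝ x)) x :=
  (EE_hasFDerivAt a b x).mul (coord_hasFDerivAt i x)

lemma inner_e (x : E2) (i : Fin 2) : inner ℝ x (e i) = x i := by
  simp [e, EuclideanSpace.inner_single_right]

lemma pd_EE (a b : ℝ) (i : Fin 2) (x : E2) :
    pd i (EE a b) x = EE (2 * (b - a / 4)) (-b / 2) x * x i := by
  simp [pd, (EE_hasFDerivAt a b x).fderiv, inner_e]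
  simp only [EE]; ring_nf; simp

lemma pd_EEc (a b : ℝ) (i j : Fin 2) (x : E2) :
    pd j (fun y => EE a b y * y i) x =
      EE (2 * (b - a / 4)) (-b / 2) x * x i * x j + EE a b x * (e j) i := by
  simp [pd, (EEc_hasFDerivAt a b i x).fderiv, inner_e]
  simp [EE]; ring

lemma G_eq : G = EE (4 * π)⁻¹ 0 := by
  ext x; simp [G, EE]

lemma F_eq (i : Fin 2) : F i = fun x => EE (-(4 * π)⁻¹ / 2) 0 x * x i := by
  ext x
  rw [F, G_eq, pd_EE]
  simp only [EE]; ring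

lemma nsq (x : E2) : ‖x‖ ^ 2 = x 0 ^ 2 + x 1 ^ 2 := by
  simp [EuclideanSpace.norm_sq_eq, Fin.sum_univ_two]

lemma lap_G (x : E2) : lap G x = EE (-(4 * π)⁻¹) ((4 * π)⁻¹ / 4) x := by
  have h : ∀ j, pd j G = fun x => EE (-(4 * π)⁻¹ / 2) 0 x * x j := fun j => F_eq j
  simp only [lap, h, pd_EEc, Fin.sum_univ_two]
  simp [EE, e, nsq]; ring

lemma pd_EEcc (a b : ℝ) (i j k : Fin 2) (d : ℝ) (x : E2) (a' b' : ℝ) :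
    pd k (fun y => EE a b y * y i * y j + EE a' b' y * d) x =
      EE (2 * (b - a / 4)) (-b / 2) x * x i * x j * x k + EE a b x * (e k) i * x j
      + EE a b x * x i * (e k) j + EE (2 * (b' - a' / 4)) (-b' / 2) x * x k * d := by
  have h := ((EEc_hasFDerivAt a b i x).mul (coord_hasFDerivAt j x)).add
    ((EE_hasFDerivAt a' b' x).mul_const d)
  have h' := h.fderiv
  simp only [pd]
  erw [h']
  simp [inner_e]
  simp [EE]; ring

lemma lap_F (i : Fin 2) (x : E2) :
    lap (F i) x = EE ((4 * π)⁻¹) (-(4 * π)⁻¹ / 8) x * x i := by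
  have h : ∀ j, pd j (F i) = fun x => EE (2 * (0 - (-(4 * π)⁻¹ / 2) / 4)) (-0 / 2) x * x i * x j
      + EE (-(4 * π)⁻¹ / 2) 0 x * (e j) i := by
    intro j; ext x; rw [F_eq, pd_EEc]
  simp only [lap, h, pd_EEcc, Fin.sum_univ_two]
  fin_cases i <;> simp [EE, e, nsq] <;> ring

lemma inner_perp (x : E2) : inner ℝ x (perp x) = 0 := by
  simp [perp, PiLp.inner_apply, Fin.sum_univ_two]; ring

lemma inner_vG (x : E2) : inner ℝ x (vG x) = 0 := by
  unfold vG
  split_ifs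
  · simp
  · rw [inner_smul_right, inner_perp, mul_zero]

lemma vG_diff (x : E2) (hx : x ≠ 0) : DifferentiableAt ℝ vG x := by
  have hp : DifferentiableAt ℝ perp x := by
    rw [differentiableAt_euclidean]
    intro i
    fin_cases i
    · simpa [perp] using (coord_hasFDerivAt 1 x).differentiableAt.neg
    · simpa [perp] using (coord_hasFDerivAt 0 x).differentiableAt
  have hn : DifferentiableAt ℝ (fun y : E2 => ‖y‖ ^ 2) x :=
    (hasStrictFDerivAt_norm_sq x).hasFDerivAt.differentiableAt
  have hx2 : ‖x‖ ^ 2 ≠ 0 := by simpa using hx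
  have h : DifferentiableAt ℝ (fun ξ : E2 =>
      ((2 * π)⁻¹ * ((1 - Real.exp (-‖ξ‖ ^ 2 / 4)) / ‖ξ‖ ^ 2)) • perp ξ) x := by
    have a1 : DifferentiableAt ℝ (fun y : E2 => 1 - Real.exp (-‖y‖ ^ 2 / 4)) x := by
      simpa [EE] using (EE_hasFDerivAt 1 0 x).differentiableAt.const_sub 1
    have a2 : DifferentiableAt ℝ
        (fun y : E2 => (1 - Real.exp (-‖y‖ ^ 2 / 4)) / ‖y‖ ^ 2) x := by
      simp only [div_eq_mul_inv] at a1 ⊢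
      exact a1.mul (hn.inv hx2)
    exact (a2.const_mul _).smul hp
  refine h.congr_of_eventuallyEq ?_
  filter_upwards [isOpen_ne.mem_nhds hx] with y hy
  simp [vG, show y ≠ 0 from hy]

lemma inner_vF (i : Fin 2) (x : E2) (hx : x ≠ 0) : inner ℝ x (vF i x) = - (vG x) i := by
  have h := (hasFDerivAt_id (𝕜 := ℝ) x).inner ℝ (vG_diff x hx).hasFDerivAt
  have h0 : (fun y : E2 => inner ℝ (id y) (vG y)) = fun _ => (0 : ℝ) := by
    ext y; exact inner_vG y
  rw [h0] at h
  have h1 := congrArg (fun L => L (e i)) (h.unique (hasFDerivAt_const (0 : ℝ) x))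
  simp [fderivInnerCLM_apply] at h1
  rw [real_inner_comm (vG x) (e i), inner_e] at h1
  unfold vF
  linarith

/-- `v^{F_i}·∇Γ + v^G·∇Λ_i = 0`, stated via directional derivatives. -/
theorem vF_Gamma_plus_vG_Lambda (α : ℝ) (hα : 0 < α) (i : Fin 2)
    (ξ : E2) (hξ : ξ ≠ 0) (τ : ℝ) :
    fderiv ℝ (fun y => Γfn α y τ) ξ (vF i ξ)
      + fderiv ℝ (fun y => Λfn α i y τ) ξ (vG ξ) = 0 := by
  set k := α ^ 2 * Real.exp (-τ) with hk
  set c := (4 * π)⁻¹ with hc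
  have h1 : (fun y => Γfn α y τ) = EE (c + k * c) (- k * c / 4) := by
    ext y
    rw [Γfn, lap_G, G_eq]
    simp only [EE, ← hk, ← hc]; ring
  have h2 : (fun y => Λfn α i y τ) = fun y => EE (- c / 2 - k * c) (k * c / 8) y * y i := by
    ext y
    rw [Λfn, lap_F, F_eq]
    simp only [EE, ← hk, ← hc]; ring
  rw [h1, h2, (EE_hasFDerivAt _ _ ξ).fderiv, (EEc_hasFDerivAt _ _ i ξ).fderiv]
  simp [inner_vF i ξ hξ, inner_vG]
  simp only [EE]; ring
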